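/- There exists a constant C > 0, depending only on C₀ and λ, such that for every discount rate δ ∈ (0, λ] and every triple (α, β, γ) ∈ 𝓔(δ, λ, C₀), one has α(0) ≤ C γ(0). -/

import Mathlib

open MeasureTheory

/-- `f` is càdlàg on `[0, ∞)`: right-continuous at every `t ≥ 0` and
with a (finite) left limit at every `t > 0`. -/
def CadlagOnIci (f : ℝ → ℝ) : Prop :=
  (∀ t : ℝ, 0 ≤ t → Filter.Tendsto f (nhdsWithin t (Set.Ioi t)) (nhds (f t))) ∧
  (∀ t : ℝ, 0 < t → ∃ L : ℝ, Filter.Tendsto f (nhdsWithin t (Set.Iio t)) (nhds L))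

/-- The discounted class `𝓔(δ, λ, C₀)` of triples of nonnegative bounded càdlàg
functions on `[0, ∞)` satisfying the four structural inequalities. -/
structure MemED (δ lam C₀ : ℝ) (α β γ : ℝ → ℝ) : Prop where
  cadlag_alpha : CadlagOnIci α
  cadlag_beta : CadlagOnIci β
  cadlag_gamma : CadlagOnIci γ
  nonneg_alpha : ∀ t : ℝ, 0 ≤ t → 0 ≤ α t
  nonneg_beta : ∀ t : ℝ, 0 ≤ t → 0 ≤ β t
  nonneg_gamma : ∀ t : ℝ, 0 ≤ t → 0 ≤ γ t
  bdd_alpha : ∃ M : ℝ, ∀ t : ℝ, 0 ≤ t → α t ≤ M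
  bdd_beta : ∃ M : ℝ, ∀ t : ℝ, 0 ≤ t → β t ≤ M
  bdd_gamma : ∃ M : ℝ, ∀ t : ℝ, 0 ≤ t → γ t ≤ M
  ineq1 : ∀ t₁ : ℝ, 0 ≤ t₁ →
    (∫ t in Set.Ioi t₁, Real.exp (-δ * t) * β t) ≤
      C₀ * Real.exp (-δ * t₁) * Real.sqrt (α t₁ * γ t₁)
  ineq2 : ∀ t₁ t₂ : ℝ, 0 ≤ t₁ → t₁ ≤ t₂ →
    γ t₂ ≤ C₀ * Real.exp (-lam * (t₂ - t₁)) * γ t₁ + C₀ * ∫ t in t₁..t₂, β t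
  ineq3 : ∀ t₁ : ℝ, 0 ≤ t₁ →
    α t₁ ≤ C₀ * (∫ t in Set.Ioi t₁, Real.exp (-lam * (t - t₁)) * β t)
      + C₀ * sSup ((fun t => Real.exp (-lam * (t - t₁)) * γ t) '' Set.Ici t₁)
  ineq4 : ∀ t : ℝ, 0 ≤ t → α t ≤ C₀ * β t

/-- A right-continuous function on `[0, ∞)` is almost everywhere strongly measurable there: it is
the pointwise limit of its samplings on the grids `ℤ / (n + 1)`. -/
theorem CadlagOnIci.aestronglyMeasurable {f : ℝ → ℝ} (hf : CadlagOnIci f) :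
    AEStronglyMeasurable f (volume.restrict (Set.Ioi 0)) := by
  refine aestronglyMeasurable_of_tendsto_ae Filter.atTop
    (f := fun (n : ℕ) (t : ℝ) ↦ f (((⌊((n : ℝ) + 1) * t⌋ : ℝ) + 1) / ((n : ℝ) + 1))) ?_ ?_
  · intro n
    have h : Measurable fun k : ℤ ↦ f (((k : ℝ) + 1) / ((n : ℝ) + 1)) := measurable_from_top
    exact (h.comp (measurable_const.mul measurable_id).floor).aestronglyMeasurable
  · refine (ae_restrict_mem measurableSet_Ioi).mono fun t ht ↦ ?_
    refine (hf.1 t (le_of_lt ht)).comp (tendsto_nhdsWithin_iff.2 ⟨?_, ?_⟩)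
    · have hlim : Filter.Tendsto (fun n : ℕ ↦ t + 1 / ((n : ℝ) + 1)) Filter.atTop (nhds t) := by
        simpa using tendsto_one_div_add_atTop_nhds_zero_nat.const_add t
      refine tendsto_of_tendsto_of_tendsto_of_le_of_le tendsto_const_nhds hlim ?_ ?_
      · intro n
        have hn : (0 : ℝ) < (n : ℝ) + 1 := by positivity
        have := Int.lt_floor_add_one (((n : ℝ) + 1) * t)
        change t ≤ _ / _
        rw [le_div_iff₀ hn]
        linarith
      · intro n
        have hn : (0 : ℝ) < (n : ℝ) + 1 := by positivity
        have := Int.floor_le (((n : ℝ) + 1) * t)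
        change _ / _ ≤ t + 1 / ((n : ℝ) + 1)
        rw [div_le_iff₀ hn, add_mul t, one_div_mul_cancel hn.ne']
        linarith
    · refine Filter.Eventually.of_forall fun n ↦ ?_
      have hn : (0 : ℝ) < (n : ℝ) + 1 := by positivity
      have := Int.lt_floor_add_one (((n : ℝ) + 1) * t)
      change t < _ / _
      rw [lt_div_iff₀ hn]
      linarith

theorem MemED.norm_beta_le {δ lam C₀ : ℝ} {α β γ : ℝ → ℝ} (h : MemED δ lam C₀ α β γ) :
    ∃ M : ℝ, ∀ᵐ t ∂volume.restrict (Set.Ioi (0 : ℝ)), ‖β t‖ ≤ M := by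
  obtain ⟨M, hM⟩ := h.bdd_beta
  refine ⟨M, (ae_restrict_mem measurableSet_Ioi).mono fun t ht ↦ ?_⟩
  rw [Real.norm_of_nonneg (h.nonneg_beta t (le_of_lt ht))]
  exact hM t (le_of_lt ht)

theorem MemED.integrableOn_exp_mul_beta {δ lam C₀ : ℝ} {α β γ : ℝ → ℝ}
    (h : MemED δ lam C₀ α β γ) {c : ℝ} (hc : 0 < c) :
    IntegrableOn (fun t ↦ Real.exp (-c * t) * β t) (Set.Ioi 0) := by
  obtain ⟨M, hM⟩ := h.norm_beta_le
  exact (integrableOn_exp_mul_Ioi (neg_lt_zero.2 hc) 0).mul_bdd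
    h.cadlag_beta.aestronglyMeasurable hM

theorem MemED.integrableOn_beta {δ lam C₀ : ℝ} {α β γ : ℝ → ℝ}
    (h : MemED δ lam C₀ α β γ) (t : ℝ) :
    IntegrableOn β (Set.Ioc 0 t) := by
  obtain ⟨M, hM⟩ := h.norm_beta_le
  have hsub : Set.Ioc 0 t ⊆ Set.Ioi (0 : ℝ) := Set.Ioc_subset_Ioi_self
  exact Integrable.of_bound (h.cadlag_beta.aestronglyMeasurable.mono_set hsub) M
    (ae_restrict_of_ae_restrict_of_subset hsub hM)

/-- The discounted mass of `β` on `[0, ∞)` dominates `e^{-λt}` times its mass on `[0, t]`. -/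
theorem MemED.exp_mul_integral_beta_le {δ lam C₀ : ℝ} {α β γ : ℝ → ℝ}
    (h : MemED δ lam C₀ α β γ) (hδ : 0 < δ) (hδlam : δ ≤ lam) {t : ℝ} (ht : 0 ≤ t) :
    Real.exp (-lam * t) * ∫ s in (0 : ℝ)..t, β s ≤
      ∫ s in Set.Ioi 0, Real.exp (-δ * s) * β s := by
  have hint := h.integrableOn_exp_mul_beta hδ
  have hsub : Set.Ioc 0 t ⊆ Set.Ioi (0 : ℝ) := Set.Ioc_subset_Ioi_self
  rw [intervalIntegral.integral_of_le ht, ← integral_const_mul]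
  calc ∫ s in Set.Ioc 0 t, Real.exp (-lam * t) * β s
      ≤ ∫ s in Set.Ioc 0 t, Real.exp (-δ * s) * β s := by
        refine setIntegral_mono_on ((h.integrableOn_beta t).const_mul _)
          (hint.mono_set hsub) measurableSet_Ioc fun s hs ↦ ?_
        refine mul_le_mul_of_nonneg_right (Real.exp_le_exp.2 ?_) (h.nonneg_beta s hs.1.le)
        nlinarith [hs.1, hs.2, mul_le_mul hδlam hs.2 hs.1.le (hδ.le.trans hδlam)]
    _ ≤ ∫ s in Set.Ioi 0, Real.exp (-δ * s) * β s := by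
        refine setIntegral_mono_set hint ?_ hsub.eventuallyLE
        refine (ae_restrict_mem measurableSet_Ioi).mono fun s hs ↦ ?_
        exact mul_nonneg (Real.exp_pos _).le (h.nonneg_beta s (le_of_lt hs))

/-- Initial-time comparison: there exists `C > 0` depending only on `C₀` and `λ`
such that for every `δ ∈ (0, λ]` and every `(α, β, γ) ∈ 𝓔(δ, λ, C₀)`,
`α(0) ≤ C γ(0)`. -/
theorem alpha_zero_le_gamma_zero (lam C₀ : ℝ) (hlam : 0 < lam) (hC₀ : 0 < C₀) :
    ∃ C : ℝ, 0 < C ∧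
      ∀ δ : ℝ, 0 < δ → δ ≤ lam → ∀ α β γ : ℝ → ℝ, MemED δ lam C₀ α β γ →
        α 0 ≤ C * γ 0 := by
  refine ⟨(C₀ ^ 2 + C₀ ^ 3) ^ 2 + 2 * C₀ ^ 2, by positivity, ?_⟩
  intro δ hδ hδlam α β γ h
  have hα := h.nonneg_alpha 0 le_rfl
  have hγ := h.nonneg_gamma 0 le_rfl
  set I := ∫ s in Set.Ioi 0, Real.exp (-δ * s) * β s with hI
  set r := Real.sqrt (α 0 * γ 0) with hr
  have hIr : I ≤ C₀ * r := by simpa [hI, hr] using h.ineq1 0 le_rfl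
  have hlamI : ∫ t in Set.Ioi (0 : ℝ), Real.exp (-lam * (t - 0)) * β t ≤ I := by
    simp only [sub_zero]
    refine setIntegral_mono_on (h.integrableOn_exp_mul_beta hlam)
      (h.integrableOn_exp_mul_beta hδ) measurableSet_Ioi fun s hs ↦ ?_
    have hs : 0 < s := hs
    refine mul_le_mul_of_nonneg_right (Real.exp_le_exp.2 ?_) (h.nonneg_beta s hs.le)
    nlinarith
  have hsup : sSup ((fun t ↦ Real.exp (-lam * (t - 0)) * γ t) '' Set.Ici 0) ≤
      C₀ * γ 0 + C₀ * I := by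
    refine csSup_le (Set.nonempty_Ici.image _) ?_
    rintro _ ⟨t, ht, rfl⟩
    have ht : 0 ≤ t := ht
    have hexp : Real.exp (-lam * t) ≤ 1 := Real.exp_le_one_iff.2 (by nlinarith)
    have hpos := Real.exp_pos (-lam * t)
    have hβ := h.exp_mul_integral_beta_le hδ hδlam ht
    have h2 := h.ineq2 0 t le_rfl ht
    simp only [sub_zero] at h2 ⊢
    calc Real.exp (-lam * t) * γ t
        ≤ Real.exp (-lam * t) *
            (C₀ * Real.exp (-lam * t) * γ 0 + C₀ * ∫ s in (0 : ℝ)..t, β s) := by gcongr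
      _ = C₀ * (Real.exp (-lam * t) * Real.exp (-lam * t) * γ 0) +
            C₀ * (Real.exp (-lam * t) * ∫ s in (0 : ℝ)..t, β s) := by ring
      _ ≤ C₀ * γ 0 + C₀ * I := by
        gcongr
        exact mul_le_of_le_one_left hγ (mul_le_one₀ hexp hpos.le hexp)
  have hbound : α 0 ≤ (C₀ ^ 2 + C₀ ^ 3) * r + C₀ ^ 2 * γ 0 :=
    calc α 0 ≤ _ := h.ineq3 0 le_rfl
      _ ≤ C₀ * (C₀ * r) + C₀ * (C₀ * γ 0 + C₀ * (C₀ * r)) := by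
        gcongr
        · exact hlamI.trans hIr
        · exact hsup.trans (by gcongr)
      _ = _ := by ring
  have hamgm : (C₀ ^ 2 + C₀ ^ 3) * r ≤ (α 0 + (C₀ ^ 2 + C₀ ^ 3) ^ 2 * γ 0) / 2 := by
    rw [hr, Real.sqrt_mul hα]
    nlinarith [sq_nonneg (√(α 0) - (C₀ ^ 2 + C₀ ^ 3) * √(γ 0)), Real.sq_sqrt hα,
      Real.sq_sqrt hγ]
  linarith
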